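/- arXiv:math/0403230 — 3 statements merged into one kernel-verified Lean document; each statement's English description precedes it below -/
import Mathlib

section
/- Let A and B be direct factors of a finite group G such that no nontrivial direct factor of A is isomorphic to a direct factor of B (A and B are coprime). Then A ∩ B = 1 and A·B is a direct factor of G. -/
/-- `A` is a direct factor of `G`: there is a normal complement. -/
def Subgroup.IsDirectFactor {G : Type*} [Group G] (A : Subgroup G) : Prop :=
  A.Normal ∧ ∃ U : Subgroup G, U.Normal ∧ A ⊓ U = ⊥ ∧ A ⊔ U = ⊤

/-- Two groups are coprime: no nontrivial direct factor of one is isomorphic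
to a direct factor of the other. -/
def GroupCoprime (A B : Type*) [Group A] [Group B] : Prop :=
  ∀ (A₁ : Subgroup A) (B₁ : Subgroup B),
    A₁.IsDirectFactor → B₁.IsDirectFactor → Nonempty (A₁ ≃* B₁) → A₁ = ⊥

theorem end_mul_ap {G : Type*} [Group G] (f g : Monoid.End G) (x : G) :
    (f * g) x = f (g x) := rfl

/-- The projection attached to a direct decomposition. -/
theorem exists_proj {G : Type*} [Group G] (A U : Subgroup G) (hA : A.Normal) (hU : U.Normal)
    (hi : A ⊓ U = ⊥) (hs : A ⊔ U = ⊤) :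
    ∃ α : Monoid.End G, (∀ x, α x ∈ A) ∧ (∀ x ∈ A, α x = x) ∧ (∀ x, α x = 1 ↔ x ∈ U) ∧
      (∀ g x, α (g * x * g⁻¹) = g * α x * g⁻¹) := by
  have hd : Disjoint A U := disjoint_iff.2 hi
  have hc : ∀ a ∈ A, ∀ u ∈ U, a * u = u * a := fun a ha u hu =>
    Subgroup.commute_of_normal_of_disjoint A U hA hU hd a u ha hu
  have hex : ∀ g : G, ∃ a u, a ∈ A ∧ u ∈ U ∧ g = a * u := by
    intro g
    have hg : g ∈ A ⊔ U := by rw [hs]; trivial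
    obtain ⟨a, ha, u, hu, h⟩ := Subgroup.mem_sup_of_normal_right.1 hg
    exact ⟨a, u, ha, hu, h.symm⟩
  choose p q hp hq hpq using hex
  have huniq : ∀ a ∈ A, ∀ u ∈ U, p (a * u) = a := by
    intro a ha u hu
    have h := hpq (a * u)
    have h1 : a⁻¹ * p (a * u) = u * (q (a * u))⁻¹ := by
      rw [eq_mul_inv_iff_mul_eq, mul_assoc, ← h]; group
    have h2 : a⁻¹ * p (a * u) ∈ A ⊓ U :=
      ⟨A.mul_mem (A.inv_mem ha) (hp _), by
        rw [h1]; exact U.mul_mem hu (U.inv_mem (hq _))⟩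
    rw [hi, Subgroup.mem_bot] at h2
    exact (inv_mul_eq_one.1 h2).symm
  have hmul : ∀ x y, p (x * y) = p x * p y := by
    intro x y
    have : x * y = (p x * p y) * (q x * q y) := by
      conv_lhs => rw [hpq x, hpq y]
      rw [mul_assoc, ← mul_assoc (q x), ← hc _ (hp y) _ (hq x)]
      group
    rw [this, huniq _ (A.mul_mem (hp x) (hp y)) _ (U.mul_mem (hq x) (hq y))]
  let α : G →* G := MonoidHom.mk' p hmul
  have hα : ∀ x, α x = p x := fun _ => rfl
  refine ⟨α, fun x => hp x, ?_, ?_, ?_⟩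
  · intro x hx
    have := huniq x hx 1 U.one_mem
    rwa [mul_one] at this
  · intro x
    constructor
    · intro h
      have h' : p x = 1 := h
      rw [hpq x, h', one_mul]; exact hq x
    · intro hx
      have := huniq 1 A.one_mem x hx
      rwa [one_mul] at this
  · intro g x
    have e : p (g * x * g⁻¹) = p g * p x * (p g)⁻¹ := by
      have := map_mul_inv α (g * x) g
      rw [map_mul α g x] at this
      exact this
    change p (g * x * g⁻¹) = g * p x * g⁻¹
    rw [e]
    have h2 : g * p x * g⁻¹ = (p g * q g) * p x * (p g * q g)⁻¹ := by rw [← hpq g]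
    rw [h2, mul_assoc (p g) (q g), ← hc _ (hp x) _ (hq g)]
    group

theorem exists_idem_pow {M : Type*} [Monoid M] [Finite M] (t : M) :
    ∃ n, t ^ (n + 1) * t ^ (n + 1) = t ^ (n + 1) := by
  obtain ⟨i, j, hne, h⟩ := Finite.exists_ne_map_eq_of_infinite (fun n : ℕ => t ^ n)
  wlog hij : i < j generalizing i j
  · exact this j i hne.symm h.symm (by omega)
  obtain ⟨d, rfl⟩ := Nat.exists_eq_add_of_lt hij
  have h1 : ∀ m, t ^ (i + m) = t ^ (i + m + (d + 1)) := by
    intro m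
    rw [pow_add, h, ← pow_add]; congr 1; omega
  have h2 : ∀ k m, t ^ (i + m) = t ^ (i + m + k * (d + 1)) := by
    intro k
    induction k with
    | zero => intro m; simp
    | succ k ih =>
      intro m
      rw [ih m, add_assoc i, h1 (m + k * (d + 1))]; congr 1; ring
  refine ⟨i * (d + 1) + d, ?_⟩
  have h3 := h2 (i + 1) (i * d + d + 1)
  rw [← pow_add]
  have e1 : i + (i * d + d + 1) = i * (d + 1) + d + 1 := by ring
  have e2 : i + (i * d + d + 1) + (i + 1) * (d + 1)
    = i * (d + 1) + d + 1 + (i * (d + 1) + d + 1) := by ring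
  rw [e2, e1] at h3
  exact h3.symm

theorem isDirectFactor_subgroupOf {G : Type*} [Group G] (A A₁ K : Subgroup G)
    (h1 : A₁.Normal) (hK : K.Normal) (hle : A₁ ≤ A)
    (hi : ∀ x ∈ A₁, x ∈ K → x = 1) (hs : ∀ a ∈ A, ∃ x ∈ A₁, x⁻¹ * a ∈ K) :
    (A₁.subgroupOf A).IsDirectFactor := by
  refine ⟨h1.subgroupOf A, K.subgroupOf A, hK.subgroupOf A, ?_, ?_⟩
  · rw [eq_bot_iff]
    rintro x ⟨hx, hx'⟩
    rw [Subgroup.mem_bot]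
    exact Subtype.ext (hi x hx hx')
  · rw [eq_top_iff]
    rintro ⟨a, ha⟩ -
    obtain ⟨x, hx, hk⟩ := hs a ha
    have : (⟨a, ha⟩ : A) = ⟨x, hle hx⟩ * (⟨x, hle hx⟩⁻¹ * ⟨a, ha⟩) := by group
    rw [this]
    exact Subgroup.mul_mem_sup hx hk

theorem coprime_direct_factors
    {G : Type*} [Group G] [Finite G] (A B : Subgroup G)
    (hA : A.IsDirectFactor) (hB : B.IsDirectFactor)
    (hcop : GroupCoprime A B) :
    A ⊓ B = ⊥ ∧ (A ⊔ B).IsDirectFactor := by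
  obtain ⟨hAn, U, hUn, hAU, hAU'⟩ := hA
  obtain ⟨hBn, V, hVn, hBV, hBV'⟩ := hB
  obtain ⟨α, αA, αid, αU, αn⟩ := exists_proj A U hAn hUn hAU hAU'
  obtain ⟨β, βB, βid, βV, βn⟩ := exists_proj B V hBn hVn hBV hBV'
  have : Finite (Monoid.End G) := Finite.of_injective (fun f : Monoid.End G => (f : G → G))
    DFunLike.coe_injective
  obtain ⟨θ, hθ⟩ : ∃ θ : Monoid.End G, θ = α * β := ⟨_, rfl⟩
  have θap : ∀ x, θ x = α (β x) := fun x => by rw [hθ]; rfl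
  obtain ⟨n, hn⟩ := exists_idem_pow θ
  have pown : ∀ k g x, (θ ^ k) (g * x * g⁻¹) = g * (θ ^ k) x * g⁻¹ := by
    intro k
    induction k with
    | zero => intro g x; rfl
    | succ k ih =>
      intro g x
      rw [pow_succ, end_mul_ap, end_mul_ap, θap, βn, αn, ih, θap]
  obtain ⟨ε, hε⟩ : ∃ ε : Monoid.End G, ε = θ ^ (n + 1) := ⟨_, rfl⟩
  have εn : ∀ g x, ε (g * x * g⁻¹) = g * ε x * g⁻¹ := by rw [hε]; exact pown _
  have εε : ∀ x, ε (ε x) = ε x := fun x => by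
    rw [← end_mul_ap, hε, hn]
  have εθ : ∀ x, (θ ^ n) (θ x) = ε x := fun x => by
    rw [hε, pow_succ]; rfl
  have θε : ∀ x, θ ((θ ^ n) x) = ε x := fun x => by
    rw [hε, pow_succ']; rfl
  have εA : ∀ x, ε x ∈ A := fun x => by rw [← θε, θap]; exact αA _
  have comm : ∀ x, θ (ε x) = ε (θ x) := fun x => by
    rw [← θε (θ x), εθ]
  have inj : ∀ x, β (ε x) = 1 → ε x = 1 := by
    intro x hx
    have h : θ (ε x) = 1 := by rw [θap, hx, map_one]
    rw [← εε, ← εθ, h, map_one]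
  -- the factor A₁
  have nrm : ∀ f : Monoid.End G, (∀ g x, f (g * x * g⁻¹) = g * f x * g⁻¹) →
      (MonoidHom.range (f : G →* G)).Normal := by
    intro f hf
    refine ⟨?_⟩
    rintro _ ⟨x, rfl⟩ g
    exact ⟨g * x * g⁻¹, hf g x⟩
  have eps1 : ∀ x, ε x = 1 := by
    let A₁ : Subgroup G := MonoidHom.range (ε : G →* G)
    let B₁ : Subgroup G := MonoidHom.range (β * ε : Monoid.End G)
    have hA₁ : A₁ ≤ A := by rintro _ ⟨x, rfl⟩; exact εA x
    have hB₁ : B₁ ≤ B := by rintro _ ⟨x, rfl⟩; exact βB _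
    have dA : (A₁.subgroupOf A).IsDirectFactor := by
      refine isDirectFactor_subgroupOf A A₁ (MonoidHom.ker (ε : G →* G)) (nrm ε εn)
        (MonoidHom.normal_ker (G := G) (M := G) ε) hA₁ ?_ ?_
      · rintro _ ⟨x, rfl⟩ hx
        exact (εε x).symm.trans hx
      · intro a _
        refine ⟨ε a, ⟨a, rfl⟩, ?_⟩
        change ε ((ε a)⁻¹ * a) = 1
        rw [map_mul, map_inv, εε, inv_mul_cancel]
    have dB : (B₁.subgroupOf B).IsDirectFactor := by
      refine isDirectFactor_subgroupOf B B₁ (MonoidHom.ker (ε * α : Monoid.End G))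
        (nrm (β * ε) fun g x => ?_) (MonoidHom.normal_ker (G := G) (M := G) (ε * α : Monoid.End G)) hB₁ ?_ ?_
      · rw [end_mul_ap, end_mul_ap, εn, βn]
      · rintro _ ⟨x, rfl⟩ hx
        have hx' : ε (α (β (ε x))) = 1 := hx
        change β (ε x) = 1
        rw [← θap, ← comm, εε] at hx'
        rw [← εε, ← εθ, hx', map_one, map_one]
      · intro b _
        refine ⟨β (ε ((θ ^ n) (α b))), ⟨(θ ^ n) (α b), rfl⟩, ?_⟩
        change ε (α ((β (ε ((θ ^ n) (α b))))⁻¹ * b)) = 1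
        rw [map_mul, map_mul, map_inv, map_inv, ← θap, comm, θε, εε, εε, inv_mul_cancel]
    have hiso : Nonempty (A₁ ≃* B₁) := by
      let f : A₁ →* B₁ := ((β : G →* G).comp A₁.subtype).codRestrict B₁ (by
        rintro ⟨_, x, rfl⟩; exact ⟨x, rfl⟩)
      refine ⟨MulEquiv.ofBijective f ⟨?_, ?_⟩⟩
      · rw [injective_iff_map_eq_one]
        rintro ⟨_, x, rfl⟩ h
        exact Subtype.ext (inj x (congrArg Subtype.val h))
      · rintro ⟨_, x, rfl⟩
        exact ⟨⟨ε x, x, rfl⟩, rfl⟩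
    obtain ⟨e⟩ := hiso
    have hb := hcop _ _ dA dB ⟨(Subgroup.subgroupOfEquivOfLe hA₁).trans
      (e.trans (Subgroup.subgroupOfEquivOfLe hB₁).symm)⟩
    intro x
    have hm : (⟨ε x, εA x⟩ : A) ∈ A₁.subgroupOf A := ⟨x, rfl⟩
    rw [hb, Subgroup.mem_bot] at hm
    exact congrArg Subtype.val hm
  have fix : ∀ x, θ x = x → x = 1 := by
    intro x hx
    have : ∀ k, (θ ^ k) x = x := by
      intro k
      induction k with
      | zero => rfl
      | succ k ih => rw [pow_succ, end_mul_ap, hx, ih]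
    rw [← this (n + 1), ← hε]; exact eps1 x
  have fix2 : ∀ b, β (α b) = b → b = 1 := by
    intro b hb
    have : α b = 1 := fix _ (by rw [θap, hb])
    rw [← hb, this, map_one]
  have hdA : ∀ b, (α b)⁻¹ * b ∈ U := fun b => by
    rw [← αU, map_mul, map_inv, αid _ (αA b), inv_mul_cancel]
  -- b ↦ β ((α b)⁻¹ b) is injective on B, hence surjective
  have injB : ∀ b ∈ B, β ((α b)⁻¹ * b) = 1 → b = 1 := by
    intro b hb h
    rw [map_mul, map_inv, βid b hb, inv_mul_eq_one] at h
    exact fix2 b h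
  have cAU : ∀ a ∈ A, ∀ u ∈ U, a * u = u * a := fun a ha u hu =>
    Subgroup.commute_of_normal_of_disjoint A U hAn hUn (disjoint_iff.2 hAU) a u ha hu
  have pmul : ∀ x y, (α (x * y))⁻¹ * (x * y) = ((α x)⁻¹ * x) * ((α y)⁻¹ * y) := by
    intro x y
    have h := cAU _ (A.inv_mem (αA y)) _ (hdA x)
    calc (α (x * y))⁻¹ * (x * y) = ((α y)⁻¹ * ((α x)⁻¹ * x)) * y := by rw [map_mul]; group
      _ = ((α x)⁻¹ * x) * ((α y)⁻¹ * y) := by rw [h]; group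
  let π : G →* G := MonoidHom.mk' (fun x => (α x)⁻¹ * x) pmul
  have πap : ∀ x, π x = (α x)⁻¹ * x := fun _ => rfl
  let F : B →* B := (((β : G →* G).comp π).comp B.subtype).codRestrict B (fun x => βB _)
  have Finj : Function.Injective F := by
    rw [injective_iff_map_eq_one]
    rintro ⟨b, hb⟩ h
    exact Subtype.ext (injB b hb (congrArg Subtype.val h))
  have Fsurj : Function.Surjective F := Finite.surjective_of_injective Finj
  refine ⟨?_, Subgroup.sup_normal A B, U ⊓ V, inferInstance, ?_, ?_⟩
  · rw [eq_bot_iff]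
    rintro x ⟨hx, hx'⟩
    rw [Subgroup.mem_bot]
    exact fix x (by rw [θap, βid x hx', αid x hx])
  · rw [eq_bot_iff]
    rintro x ⟨hx, hxU, hxV⟩
    rw [Subgroup.mem_bot]
    obtain ⟨a, ha, b, hb, rfl⟩ := Subgroup.mem_sup_of_normal_right.1 hx
    have h1 := (αU _).2 hxU
    rw [map_mul, αid a ha] at h1
    have h2 : a = (α b)⁻¹ := eq_inv_of_mul_eq_one_left h1
    have h3 := (βV _).2 hxV
    rw [h2] at h3
    have h4 := injB b hb h3
    rw [h2, h4, map_one]; simp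
  · rw [eq_top_iff]
    rintro g -
    -- write the U-part of g as (π b) * w
    obtain ⟨⟨b, hb⟩, hFb⟩ := Fsurj ⟨β (π g), βB _⟩
    have hFb' : β (π b) = β (π g) := congrArg Subtype.val hFb
    have hw : (π b)⁻¹ * π g ∈ U ⊓ V := by
      refine ⟨U.mul_mem (U.inv_mem (hdA b)) (hdA g), ?_⟩
      change (π b)⁻¹ * π g ∈ V
      rw [← βV, map_mul, map_inv, hFb', inv_mul_cancel]
    have hg : g = (α g * ((α b)⁻¹ * b)) * ((π b)⁻¹ * π g) := by
      rw [← πap b, πap g]; group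
    rw [hg]
    refine Subgroup.mul_mem_sup ?_ hw
    rw [← mul_assoc]
    exact Subgroup.mul_mem_sup (A.mul_mem (αA g) (A.inv_mem (αA b))) hb
end

section
/- Let G be a finite perfect group (G' = G) with internal direct decomposition G = H · K, and let H₀ be a normal subgroup of G with H₀ ≅ H and G/H₀ ≅ K. Then H₀ is a direct factor of G. -/
/-- `DecSq G s`: `G` has an iterated direct product decomposition such that the sum of the
squares of the numbers of prime factors of the orders of the pieces is `s`. -/
inductive DecSq.{u} : (G : Type u) → [Group G] → ℕ → Prop
  | leaf (G : Type u) [Group G] : DecSq G ((Nat.card G).primeFactorsList.length ^ 2)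
  | node (G U V : Type u) [Group G] [Group U] [Group V] (e : G ≃* U × V) (s t : ℕ)
      (hs : DecSq U s) (ht : DecSq V t) : DecSq G (s + t)

theorem DecSq.congr.{u} {G G' : Type u} [Group G] [Group G'] (e : G' ≃* G) {s : ℕ}
    (h : DecSq G s) : DecSq G' s := by
  cases h with
  | leaf =>
    rw [← Nat.card_congr e.toEquiv]
    exact DecSq.leaf G'
  | node _ U V f s t hs ht => exact DecSq.node G' _ _ (e.trans f) s t hs ht

theorem eq_prod_of_perfect {U V : Type*} [Group U] [Group V] (N : Subgroup (U × V))
    (hN : N.Normal) (hp : ⁅N, N⁆ = N) :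
    N = (N.map (MonoidHom.fst U V)).prod (N.map (MonoidHom.snd U V)) := by
  have hU : ∀ x ∈ N.map (MonoidHom.fst U V), (x, (1 : V)) ∈ N := by
    have : N.map (MonoidHom.fst U V) ≤ N.comap (MonoidHom.inl U V) := by
      conv_lhs => rw [← hp, Subgroup.map_commutator]
      rw [Subgroup.commutator_le]
      rintro _ ⟨⟨a, b⟩, hab, rfl⟩ _ ⟨⟨c, d⟩, hcd, rfl⟩
      have h := N.mul_mem hab (hN.conj_mem _ (N.inv_mem hab) (c, 1))
      simpa [commutatorElement_def, mul_assoc] using h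
    exact this
  have hV : ∀ x ∈ N.map (MonoidHom.snd U V), ((1 : U), x) ∈ N := by
    have : N.map (MonoidHom.snd U V) ≤ N.comap (MonoidHom.inr U V) := by
      conv_lhs => rw [← hp, Subgroup.map_commutator]
      rw [Subgroup.commutator_le]
      rintro _ ⟨⟨a, b⟩, hab, rfl⟩ _ ⟨⟨c, d⟩, hcd, rfl⟩
      have h := N.mul_mem hab (hN.conj_mem _ (N.inv_mem hab) (1, d))
      simpa [commutatorElement_def, mul_assoc] using h
    exact this
  apply le_antisymm
  · intro x hx
    exact ⟨⟨x, hx, rfl⟩, ⟨x, hx, rfl⟩⟩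
  · rintro ⟨a, b⟩ ⟨ha, hb⟩
    have := N.mul_mem (hU a ha) (hV b hb)
    simpa using this

def IsDF {G : Type*} [Group G] (N : Subgroup G) : Prop :=
  ∃ K₀ : Subgroup G, K₀.Normal ∧ N ⊔ K₀ = ⊤ ∧ N ⊓ K₀ = ⊥

theorem IsDF.prod {U V : Type*} [Group U] [Group V] {A : Subgroup U} {B : Subgroup V}
    (hA : IsDF A) (hB : IsDF B) : IsDF (A.prod B) := by
  obtain ⟨C, hC, hC1, hC2⟩ := hA
  obtain ⟨D, hD, hD1, hD2⟩ := hB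
  refine ⟨C.prod D, inferInstance, ?_, ?_⟩
  · rw [eq_top_iff]
    rintro ⟨x, y⟩ -
    have hx : x ∈ A ⊔ C := hC1 ▸ Subgroup.mem_top x
    have hy : y ∈ B ⊔ D := hD1 ▸ Subgroup.mem_top y
    rw [Subgroup.mem_sup_of_normal_right] at hx hy
    obtain ⟨a, ha, c, hc, rfl⟩ := hx
    obtain ⟨b, hb, d, hd, rfl⟩ := hy
    exact Subgroup.mul_mem_sup (x := (a, b)) (y := (c, d)) ⟨ha, hb⟩ ⟨hc, hd⟩
  · rw [eq_bot_iff]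
    rintro ⟨x, y⟩ ⟨⟨h1, h2⟩, ⟨h3, h4⟩⟩
    have hx : x ∈ A ⊓ C := ⟨h1, h3⟩
    have hy : y ∈ B ⊓ D := ⟨h2, h4⟩
    rw [hC2] at hx
    rw [hD2] at hy
    rw [Subgroup.mem_bot] at hx hy ⊢
    rw [hx, hy]; rfl

theorem IsDF.of_map {G G' : Type*} [Group G] [Group G'] (e : G ≃* G') {N : Subgroup G}
    (h : IsDF (N.map e.toMonoidHom)) : IsDF N := by
  obtain ⟨C, hC, h1, h2⟩ := h
  refine ⟨C.comap e.toMonoidHom, hC.comap _, ?_, ?_⟩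
  · apply Subgroup.map_injective (f := e.toMonoidHom) e.injective
    rw [Subgroup.map_sup, Subgroup.map_comap_eq_self_of_surjective e.surjective, h1,
      Subgroup.map_top_of_surjective _ e.surjective]
  · apply Subgroup.map_injective (f := e.toMonoidHom) e.injective
    rw [Subgroup.map_inf _ _ _ e.injective,
      Subgroup.map_comap_eq_self_of_surjective e.surjective, h2, Subgroup.map_bot]

theorem quot_prod_equiv {G U V : Type*} [Group G] [Group U] [Group V] (e : G ≃* U × V)
    (N : Subgroup G) [N.Normal] (A : Subgroup U) (B : Subgroup V) [A.Normal] [B.Normal]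
    (h : N.map e.toMonoidHom = A.prod B) : Nonempty ((G ⧸ N) ≃* (U ⧸ A) × (V ⧸ B)) := by
  let φ : G →* (U ⧸ A) × (V ⧸ B) :=
    ((QuotientGroup.mk' A).prodMap (QuotientGroup.mk' B)).comp e.toMonoidHom
  have hφ : Function.Surjective φ :=
    ((QuotientGroup.mk'_surjective A).prodMap (QuotientGroup.mk'_surjective B)).comp e.surjective
  have hk : N = φ.ker := by
    ext x
    have h1 : x ∈ N ↔ e x ∈ N.map e.toMonoidHom :=
      (Subgroup.mem_map_iff_mem (f := e.toMonoidHom) e.injective).symm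
    rw [h1, h, Subgroup.mem_prod, MonoidHom.mem_ker, Prod.ext_iff]
    exact and_congr (QuotientGroup.eq_one_iff _).symm (QuotientGroup.eq_one_iff _).symm
  exact ⟨(QuotientGroup.quotientMulEquivOfEq hk).trans
    (QuotientGroup.quotientKerEquivOfSurjective φ hφ)⟩

theorem key.{u} {G : Type u} [Group G] {s : ℕ} (h : DecSq G s) :
    ∀ [Finite G] (N : Subgroup G) [N.Normal], ⁅N, N⁆ = N →
    ∃ a b, DecSq N a ∧ DecSq (G ⧸ N) b ∧ a + b ≤ s ∧ (a + b = s → IsDF N) := by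
  induction h with
  | leaf G =>
    intro _ N _ _
    have hc := Subgroup.card_eq_card_quotient_mul_card_subgroup N
    have hl := (Nat.perm_primeFactorsList_mul (Nat.card_pos (α := G ⧸ N)).ne'
      (Nat.card_pos (α := N)).ne').length_eq
    rw [← hc, List.length_append] at hl
    refine ⟨_, _, DecSq.leaf N, DecSq.leaf (G ⧸ N), ?_, ?_⟩
    · rw [hl]; nlinarith
    · rw [hl]
      intro he
      have h0 : (Nat.card (G ⧸ N)).primeFactorsList.length *
        (Nat.card N).primeFactorsList.length = 0 := by nlinarith
      rcases Nat.mul_eq_zero.mp h0 with h0 | h0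
      · have : N = ⊤ := by
          rw [List.length_eq_zero_iff, Nat.primeFactorsList_eq_nil] at h0
          have := (Nat.card_pos (α := G ⧸ N)).ne'
          rw [← Subgroup.index_eq_one, Subgroup.index]
          omega
        exact ⟨⊥, inferInstance, by simp [this], by simp⟩
      · have : N = ⊥ := by
          rw [List.length_eq_zero_iff, Nat.primeFactorsList_eq_nil] at h0
          have := (Nat.card_pos (α := N)).ne'
          rw [← Subgroup.card_eq_one]
          omega
        exact ⟨⊤, inferInstance, by simp, by simp [this]⟩
  | node G U V e s t _ _ ihU ihV =>
    intro _ N hN hp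
    have : Finite (U × V) := Finite.of_equiv G e.toEquiv
    have : Finite U := Finite.of_surjective (Prod.fst : U × V → U) Prod.fst_surjective
    have : Finite V := Finite.of_surjective (Prod.snd : U × V → V) Prod.snd_surjective
    have hMn : (N.map e.toMonoidHom).Normal := hN.map _ e.surjective
    have hMp : ⁅N.map e.toMonoidHom, N.map e.toMonoidHom⁆ = N.map e.toMonoidHom := by
      rw [← Subgroup.map_commutator, hp]
    have hM := eq_prod_of_perfect _ hMn hMp
    have hAp : ⁅(N.map e.toMonoidHom).map (MonoidHom.fst U V),
        (N.map e.toMonoidHom).map (MonoidHom.fst U V)⁆ =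
        (N.map e.toMonoidHom).map (MonoidHom.fst U V) := by
      rw [← Subgroup.map_commutator, hMp]
    have hBp : ⁅(N.map e.toMonoidHom).map (MonoidHom.snd U V),
        (N.map e.toMonoidHom).map (MonoidHom.snd U V)⁆ =
        (N.map e.toMonoidHom).map (MonoidHom.snd U V) := by
      rw [← Subgroup.map_commutator, hMp]
    have hAn := hMn.map (MonoidHom.fst U V) Prod.fst_surjective
    have hBn := hMn.map (MonoidHom.snd U V) Prod.snd_surjective
    generalize (N.map e.toMonoidHom).map (MonoidHom.fst U V) = A at *
    generalize (N.map e.toMonoidHom).map (MonoidHom.snd U V) = B at *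
    obtain ⟨a, b, ha, hb, hle, heq⟩ := ihU A hAp
    obtain ⟨c, d, hc, hd, hle', heq'⟩ := ihV B hBp
    obtain ⟨q⟩ := quot_prod_equiv e N A B hM
    have n : N ≃* A × B := (N.equivMapOfInjective e.toMonoidHom e.injective).trans
      ((MulEquiv.subgroupCongr hM).trans (Subgroup.prodEquiv A B))
    refine ⟨a + c, b + d, .node _ _ _ n _ _ ha hc, .node _ _ _ q _ _ hb hd, by omega, ?_⟩
    intro h
    apply IsDF.of_map e
    rw [hM]
    exact (heq (by omega)).prod (heq' (by omega))

theorem equiv_prod {G : Type*} [Group G] (H K : Subgroup G) (hH : H.Normal) (hK : K.Normal)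
    (hHK : H ⊓ K = ⊥) (hsup : H ⊔ K = ⊤) : Nonempty (G ≃* H × K) := by
  have hcomm : ∀ (x : H) (y : K), Commute (H.subtype x) (K.subtype y) := fun x y =>
    Subgroup.commute_of_normal_of_disjoint H K hH hK (disjoint_iff.mpr hHK) x y x.2 y.2
  let φ : H × K →* G := MonoidHom.noncommCoprod H.subtype K.subtype hcomm
  have hφ : Function.Bijective φ := by
    constructor
    · rw [injective_iff_map_eq_one]
      rintro ⟨⟨x, hx⟩, ⟨y, hy⟩⟩ h
      have h' : x * y = 1 := h
      have hxy : x = y⁻¹ := eq_inv_of_mul_eq_one_left h'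
      have : x ∈ H ⊓ K := ⟨hx, hxy ▸ K.inv_mem hy⟩
      rw [hHK, Subgroup.mem_bot] at this
      subst this
      simp at h'
      subst h'
      rfl
    · intro g
      have hg : g ∈ H ⊔ K := hsup ▸ Subgroup.mem_top g
      rw [Subgroup.mem_sup_of_normal_right] at hg
      obtain ⟨x, hx, y, hy, rfl⟩ := hg
      exact ⟨(⟨x, hx⟩, ⟨y, hy⟩), rfl⟩
  exact ⟨(MulEquiv.ofBijective φ hφ).symm⟩

theorem perfect_direct_extension
    {G : Type*} [Group G] [Finite G] (hperf : commutator G = ⊤)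
    (H K : Subgroup G) (hH : H.Normal) (hK : K.Normal)
    (hHK : H ⊓ K = ⊥) (hsup : H ⊔ K = ⊤)
    (H₀ : Subgroup G) [H₀.Normal]
    (h₁ : Nonempty (H₀ ≃* H)) (h₂ : Nonempty ((G ⧸ H₀) ≃* K)) :
    ∃ K₀ : Subgroup G, K₀.Normal ∧ H₀ ⊔ K₀ = ⊤ ∧ H₀ ⊓ K₀ = ⊥ := by
  classical
  obtain ⟨f⟩ := h₁
  obtain ⟨g⟩ := h₂
  obtain ⟨e⟩ := equiv_prod H K hH hK hHK hsup
  -- `H₀` is a quotient of `G`, hence perfect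
  have hp : ⁅H₀, H₀⁆ = H₀ := by
    let ψ : G →* H₀ := f.symm.toMonoidHom.comp ((MonoidHom.fst H K).comp e.toMonoidHom)
    have hψ : Function.Surjective ψ :=
      f.symm.surjective.comp (Prod.fst_surjective.comp e.surjective)
    have hr : (⊤ : Subgroup G).map (H₀.subtype.comp ψ) = H₀ := by
      rw [← Subgroup.map_map, Subgroup.map_top_of_surjective _ hψ, ← MonoidHom.range_eq_map,
        Subgroup.range_subtype]
    have hc := congrArg (Subgroup.map (H₀.subtype.comp ψ)) hperf
    rw [commutator_def, Subgroup.map_commutator, hr] at hc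
    exact hc
  have hex : ∃ s, DecSq G s := ⟨_, DecSq.leaf G⟩
  obtain ⟨a, b, ha, hb, hle, heq⟩ := key (Nat.find_spec hex) H₀ hp
  have hG : DecSq G (a + b) :=
    DecSq.node G H K e a b (ha.congr f.symm) (hb.congr g.symm)
  exact heq (le_antisymm hle (Nat.find_min' hex hG))
end

section
/- Let G be a finite group with internal direct product decomposition G = H · K. If G ≅ H × K via some isomorphism and 1 → H → G → K → 1 is any short exact sequence of groups, then the sequence is equivalent to the direct extension; equivalently: every normal subgroup H₀ of G with H₀ ≅ H and G/H₀ ≅ K is a direct factor of G. -/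
namespace DirectExt

open Classical in
/-- If all fibres have at most `c` elements and the total is `|B| * c`, all fibres have `c`. -/
lemma fibre_eq {A B : Type*} [Finite A] [Finite B] (f : A → B) (c : ℕ)
    (hc : Nat.card A = Nat.card B * c)
    (hle : ∀ b, Nat.card {a // f a = b} ≤ c) (b : B) :
    Nat.card {a // f a = b} = c := by
  have := Fintype.ofFinite A
  have := Fintype.ofFinite B
  have h1 : Nat.card A = ∑ b, Nat.card {a // f a = b} := by
    rw [← Nat.card_sigma]
    exact Nat.card_congr (Equiv.sigmaFiberEquiv f).symm
  have h2 : ∑ b, Nat.card {a // f a = b} = ∑ _b : B, c := by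
    rw [← h1, hc]; simp
  exact (Finset.sum_eq_sum_iff_of_le (fun i _ => hle i)).1 h2 b (Finset.mem_univ b)

lemma exists_sel {α β : Type*} [Inhabited β] (P : α → β → Prop) :
    ∃ f : α → β, ∀ a b, P a b → P a (f a) := by
  classical
  refine ⟨fun a => if h : ∃ b, P a b then h.choose else default, fun a b h => ?_⟩
  have h' : ∃ b, P a b := ⟨b, h⟩
  simp only [h', dif_pos]
  exact h'.choose_spec

open Classical in
/-- Cauchy-Schwarz counting. -/
lemma cs_count {X I : Type*} [Finite X] [Finite I] (p : X → I) (σ : Equiv.Perm I) :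
    Nat.card {q : X × X // σ (p q.1) = p q.2} ≤ Nat.card {q : X × X // p q.1 = p q.2} ∧
    (Nat.card {q : X × X // σ (p q.1) = p q.2} = Nat.card {q : X × X // p q.1 = p q.2} →
      ∀ x, ∃ y, p y = σ (p x)) := by
  have := Fintype.ofFinite X
  have := Fintype.ofFinite I
  set P : I → ℕ := fun i => Nat.card {x // p x = i} with hP
  have key : ∀ τ : Equiv.Perm I,
      Nat.card {q : X × X // τ (p q.1) = p q.2} = ∑ i, P i * P (τ i) := by
    intro τ
    have : ∀ i, P i * P (τ i) = Nat.card ({x // p x = i} × {x // p x = τ i}) := by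
      intro i; rw [Nat.card_prod]
    simp_rw [this]
    rw [← Nat.card_sigma]
    refine Nat.card_congr
      { toFun := fun q => ⟨p q.1.1, ⟨q.1.1, rfl⟩, ⟨q.1.2, q.2.symm⟩⟩
        invFun := fun s => ⟨(s.2.1.1, s.2.2.1), by rw [s.2.1.2, s.2.2.2]⟩
        left_inv := fun q => rfl
        right_inv := ?_ }
    rintro ⟨i, ⟨x, rfl⟩, ⟨y, hy⟩⟩
    rfl
  have k1 := key σ
  have k2 := key 1
  simp only [Equiv.Perm.coe_one, id_eq] at k2
  have hσ : ∑ i, (P (σ i) : ℤ) * P (σ i) = ∑ i, (P i : ℤ) * P i :=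
    Equiv.sum_comp σ (fun i => (P i : ℤ) * P i)
  have hsq : ∑ i, ((P i : ℤ) - P (σ i)) ^ 2
      = 2 * (∑ i, (P i : ℤ) * P i - ∑ i, (P i : ℤ) * P (σ i)) := by
    have : ∀ i, ((P i : ℤ) - P (σ i)) ^ 2
      = (P i : ℤ) * P i + (P (σ i) : ℤ) * P (σ i) - 2 * ((P i : ℤ) * P (σ i)) := by
      intro i; ring
    simp_rw [this]
    rw [Finset.sum_sub_distrib, Finset.sum_add_distrib, hσ, ← Finset.mul_sum]
    ring
  rw [k1, k2]
  constructor
  · have : 0 ≤ ∑ i, ((P i : ℤ) - P (σ i)) ^ 2 := Finset.sum_nonneg fun i _ => sq_nonneg _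
    zify
    linarith
  · intro h x
    zify at h
    rw [h, sub_self, mul_zero,
      Finset.sum_eq_zero_iff_of_nonneg (fun i _ => sq_nonneg _)] at hsq
    have h3 := hsq (p x) (Finset.mem_univ _)
    have h4 : P (p x) = P (σ (p x)) := by
      have := pow_eq_zero_iff (two_ne_zero) |>.1 h3
      zify; linarith
    have h5 : 0 < P (p x) := by
      have : Nonempty {y // p y = p x} := ⟨⟨x, rfl⟩⟩
      exact Nat.card_pos
    rw [h4] at h5
    obtain ⟨⟨y, hy⟩⟩ := (Nat.card_pos_iff.1 h5).1
    exact ⟨y, hy⟩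

/-- Replacing a tuple in prescribed cosets commuting with given elements by a tuple in `N`. -/
lemma coset_le {G : Type*} [Group G] [Finite G] (N : Subgroup G) [N.Normal]
    {A ι : Type*} [Finite A] [Finite ι] (γ : A → Set G) (μ : ι → G ⧸ N) :
    Nat.card {p : A × (ι → G) // (∀ i, (p.2 i : G ⧸ N) = μ i) ∧
        ∀ i, ∀ g ∈ γ p.1, Commute g (p.2 i)} ≤
    Nat.card {p : A × (ι → N) // ∀ i, ∀ g ∈ γ p.1, Commute g (p.2 i : G)} := by
  have : Inhabited (ι → G) := ⟨1⟩
  obtain ⟨f, hf⟩ := exists_sel (fun (a : A) (m : ι → G) =>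
    (∀ i, (m i : G ⧸ N) = μ i) ∧ ∀ i, ∀ g ∈ γ a, Commute g (m i))
  refine Nat.card_le_card_of_injective
    (fun p => ⟨(p.1.1, fun i => ⟨(f p.1.1 i)⁻¹ * p.1.2 i, ?_⟩), ?_⟩) ?_
  · have h := hf _ _ p.2
    rw [← QuotientGroup.eq, h.1 i, p.2.1 i]
  · intro i g hg
    have h := hf _ _ p.2
    exact ((h.2 i g hg).inv_right).mul_right (p.2.2 i g hg)
  · rintro ⟨⟨a, m⟩, h⟩ ⟨⟨a', m'⟩, h'⟩ hh
    simp only [Subtype.mk.injEq, Prod.mk.injEq] at hh ⊢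
    obtain ⟨rfl, h2⟩ := hh
    refine ⟨rfl, funext fun i => ?_⟩
    have := congrFun h2 i
    simpa using this

def S1 (ι G : Type*) [Group G] : Set (G × (ι → G)) := {p | ∀ i, Commute p.1 (p.2 i)}

lemma S1_congr {ι A B : Type*} [Group A] [Group B] (e : A ≃* B) :
    Nat.card (S1 ι A) = Nat.card (S1 ι B) := by
  refine Nat.card_congr
    { toFun := fun p => ⟨(e p.1.1, fun i => e (p.1.2 i)), fun i => (p.2 i).map e⟩
      invFun := fun p => ⟨(e.symm p.1.1, fun i => e.symm (p.1.2 i)), fun i => (p.2 i).map e.symm⟩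
      left_inv := fun p => by simp
      right_inv := fun p => by simp }

lemma S1_prod {ι A B : Type*} [Group A] [Group B] :
    Nat.card (S1 ι (A × B)) = Nat.card (S1 ι A) * Nat.card (S1 ι B) := by
  rw [← Nat.card_prod]
  refine Nat.card_congr
    { toFun := fun p => (⟨(p.1.1.1, fun i => (p.1.2 i).1), fun i => (p.2 i).map (MonoidHom.fst A B)⟩,
        ⟨(p.1.1.2, fun i => (p.1.2 i).2), fun i => (p.2 i).map (MonoidHom.snd A B)⟩)
      invFun := fun p => ⟨((p.1.1.1, p.2.1.1), fun i => (p.1.1.2 i, p.2.1.2 i)),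
        fun i => Prod.commute_iff.2 ⟨p.1.2 i, p.2.2 i⟩⟩
      left_inv := fun p => rfl
      right_inv := fun p => rfl }

lemma step1 {G : Type*} [Group G] [Finite G] (N : Subgroup G) [N.Normal]
    (e : (N × (G ⧸ N)) ≃* G) (q : G ⧸ N) :
    ∃ g : G, (g : G ⧸ N) = q ∧ ∀ n : N, Commute g n := by
  have hc : Nat.card (S1 N G) = Nat.card (S1 N (G ⧸ N)) * Nat.card (S1 N N) := by
    rw [← S1_congr e, S1_prod, mul_comm]
  let F : S1 N G → S1 N (G ⧸ N) := fun p => ⟨((p.1.1 : G ⧸ N), fun i => (p.1.2 i : G ⧸ N)),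
    fun i => (p.2 i).map (QuotientGroup.mk' N)⟩
  let U : G ⧸ N → Type _ := fun q => {p : {g : G // (g : G ⧸ N) = q} × (N → N) //
    ∀ i, ∀ g ∈ ({p.1.1} : Set G), Commute g (p.2 i : G)}
  have hTU : ∀ b : S1 N (G ⧸ N), Nat.card {a // F a = b} ≤ Nat.card (U b.1.1) := by
    intro b
    refine le_trans ?_ (coset_le N (A := {g : G // (g : G ⧸ N) = b.1.1}) (fun a => {a.1}) b.1.2)
    refine Nat.card_le_card_of_injective
      (fun p => ⟨(⟨p.1.1.1, ?_⟩, p.1.1.2), ?_, ?_⟩) ?_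
    · exact congrArg (fun z => z.1.1) p.2
    · intro i
      exact congrArg (fun z => z.1.2 i) p.2
    · rintro i g rfl
      exact p.1.2 i
    · rintro ⟨⟨⟨g, m⟩, h⟩, h1⟩ ⟨⟨⟨g', m'⟩, h'⟩, h1'⟩ hh
      simpa using hh
  have hUN : ∀ q, ∃ f : U q → S1 N N, Function.Injective f ∧ ∀ u, (f u).1.2 = u.1.2 := by
    intro q
    have : Inhabited G := ⟨1⟩
    obtain ⟨f, hf⟩ := exists_sel (fun (m : N → N) (g : G) =>
      (g : G ⧸ N) = q ∧ ∀ i, Commute g (m i : G))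
    have hu : ∀ u : U q, ((u.1.1.1 : G) : G ⧸ N) = q ∧ ∀ i, Commute u.1.1.1 (u.1.2 i : G) :=
      fun u => ⟨u.1.1.2, fun i => u.2 i _ rfl⟩
    refine ⟨fun u => ⟨(⟨(f u.1.2)⁻¹ * u.1.1.1, ?_⟩, u.1.2), ?_⟩, ?_, fun u => rfl⟩
    · rw [← QuotientGroup.eq, (hf _ _ (hu u)).1, (hu u).1]
    · intro i
      have := (((hf _ _ (hu u)).2 i).inv_left).mul_left ((hu u).2 i)
      exact Subtype.ext this
    · rintro ⟨⟨⟨g, h⟩, m⟩, h1⟩ ⟨⟨⟨g', h'⟩, m'⟩, h1'⟩ hh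
      have h3 : m = m' := congrArg (fun w : S1 N N => w.1.2) hh
      subst h3
      have h2 : (f m)⁻¹ * g = (f m)⁻¹ * g' := congrArg (fun w : S1 N N => (w.1.1 : G)) hh
      have h4 := mul_left_cancel h2
      subst h4
      rfl
  have hle : ∀ b, Nat.card {a // F a = b} ≤ Nat.card (S1 N N) := by
    intro b
    obtain ⟨f, hf, -⟩ := hUN b.1.1
    exact (hTU b).trans (Nat.card_le_card_of_injective f hf)
  have heq := fibre_eq F _ hc hle ⟨(q, fun _ => 1), fun i => Commute.one_right _⟩
  obtain ⟨f, hf, hf2⟩ := hUN q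
  have h3 : Nat.card (U q) = Nat.card (S1 N N) :=
    le_antisymm (Nat.card_le_card_of_injective f hf) (heq ▸ hTU _)
  have hbij := (Nat.bijective_iff_injective_and_card f).2 ⟨hf, h3⟩
  obtain ⟨u, hu⟩ := hbij.2 ⟨(1, id), fun i => Commute.one_left _⟩
  refine ⟨u.1.1.1, u.1.1.2, fun n => ?_⟩
  have h4 := u.2 n _ rfl
  have h5 : u.1.2 = id := by rw [← hf2, hu]
  rw [h5] at h4
  exact h4

/-- Formal coboundary. -/
def D {J G : Type*} [Mul J] [Group G] (x : J → G) (s t : J) : G := x s * x t * (x (s * t))⁻¹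

lemma D_map {J A B : Type*} [Mul J] [Group A] [Group B] (f : A →* B) (x : J → A) (s t : J) :
    D (fun j => f (x j)) s t = f (D x s t) := by
  simp [D]

def S2 (J ι G : Type*) [Mul J] [Group G] : Set ((J → G) × (J → G) × (ι → G)) :=
  {p | (∀ j i, Commute (p.1 j) (p.2.2 i)) ∧ (∀ j i, Commute (p.2.1 j) (p.2.2 i)) ∧
    ∀ s t, D p.1 s t = D p.2.1 s t}

def S2map {J ι A B : Type*} [Mul J] [Group A] [Group B] (f : A →* B) (p : S2 J ι A) :
    S2 J ι B :=
  ⟨(fun j => f (p.1.1 j), fun j => f (p.1.2.1 j), fun i => f (p.1.2.2 i)),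
    fun j i => (p.2.1 j i).map f, fun j i => (p.2.2.1 j i).map f, fun s t => by
      show D (fun j => f (p.1.1 j)) s t = D (fun j => f (p.1.2.1 j)) s t
      rw [D_map, D_map, p.2.2.2 s t]⟩

lemma S2_congr {J ι A B : Type*} [Mul J] [Group A] [Group B] (e : A ≃* B) :
    Nat.card (S2 J ι A) = Nat.card (S2 J ι B) := by
  refine Nat.card_congr
    { toFun := S2map e.toMonoidHom
      invFun := S2map e.symm.toMonoidHom
      left_inv := fun p => by simp [S2map]
      right_inv := fun p => by simp [S2map] }

lemma S2_prod {J ι A B : Type*} [Mul J] [Group A] [Group B] :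
    Nat.card (S2 J ι (A × B)) = Nat.card (S2 J ι A) * Nat.card (S2 J ι B) := by
  rw [← Nat.card_prod]
  refine Nat.card_congr
    { toFun := fun p => (S2map (MonoidHom.fst A B) p, S2map (MonoidHom.snd A B) p)
      invFun := fun p => ⟨(fun j => (p.1.1.1 j, p.2.1.1 j), fun j => (p.1.1.2.1 j, p.2.1.2.1 j),
          fun i => (p.1.1.2.2 i, p.2.1.2.2 i)),
        fun j i => Prod.commute_iff.2 ⟨p.1.2.1 j i, p.2.2.1 j i⟩,
        fun j i => Prod.commute_iff.2 ⟨p.1.2.2.1 j i, p.2.2.2.1 j i⟩,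
        fun s t => Prod.ext (p.1.2.2.2 s t) (p.2.2.2.2 s t)⟩
      left_inv := fun p => rfl
      right_inv := fun p => rfl }

/-- Pairs (tuple, tuple) commuting. -/
def X (J ι N : Type*) [Group N] : Set ((J → N) × (ι → N)) :=
  {p | ∀ j i, Commute (p.1 j) (p.2 i)}

def pr {J ι N : Type*} [Mul J] [Group N] (p : X J ι N) : (J → J → N) × (ι → N) :=
  (D p.1.1, p.1.2)

def tw {J ι N : Type*} [Group N] (z : J → J → N) : Equiv.Perm ((J → J → N) × (ι → N)) :=
  (Equiv.mulLeft z).prodCongr (Equiv.refl _)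

lemma S2_card_X {J ι N : Type*} [Mul J] [Group N] :
    Nat.card (S2 J ι N) = Nat.card {q : X J ι N × X J ι N // pr q.1 = pr q.2} := by
  refine Nat.card_congr
    { toFun := fun p => ⟨(⟨(p.1.1, p.1.2.2), p.2.1⟩, ⟨(p.1.2.1, p.1.2.2), p.2.2.1⟩),
        Prod.ext (funext fun s => funext fun t => p.2.2.2 s t) rfl⟩
      invFun := fun q => ⟨(q.1.1.1.1, q.1.2.1.1, q.1.1.1.2), q.1.1.2, ?_, ?_⟩
      left_inv := fun p => rfl
      right_inv := ?_ }
  · have h : q.1.1.1.2 = q.1.2.1.2 := congrArg (fun w : (J → J → N) × (ι → N) => w.2) q.2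
    show ∀ j i, Commute (q.1.2.1.1 j) (q.1.1.1.2 i)
    rw [h]; exact q.1.2.2
  · intro s t
    exact congrFun (congrFun (congrArg Prod.fst q.2) s) t
  · rintro ⟨⟨⟨⟨x, m⟩, h⟩, ⟨⟨y, m'⟩, h'⟩⟩, hq⟩
    have h : m = m' := congrArg Prod.snd hq
    subst h
    rfl

lemma D_mul {J G : Type*} [Mul J] [Group G] (c x : J → G) (h : ∀ i j, Commute (c i) (x j))
    (s t : J) : D (fun j => c j * x j) s t = D c s t * D x s t := by
  have h1 : x s * c t = c t * x s := (h t s).eq.symm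
  have h2 : Commute (x s * x t * (x (s * t))⁻¹) (c (s * t))⁻¹ :=
    ((((h _ _).symm).mul_left (h _ _).symm).mul_left (h _ _).symm.inv_left).inv_right
  unfold D
  calc c s * x s * (c t * x t) * (c (s * t) * x (s * t))⁻¹
      = c s * (x s * c t) * x t * (x (s * t))⁻¹ * (c (s * t))⁻¹ := by group
    _ = c s * c t * ((x s * x t * (x (s * t))⁻¹) * (c (s * t))⁻¹) := by rw [h1]; group
    _ = _ := by rw [h2.eq]; group

/-- Fibre bound in step 2. -/
lemma fibre2 {G : Type*} [Group G] [Finite G] (N : Subgroup G) [N.Normal]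
    {J ι : Type*} [Mul J] [Finite J] [Finite ι] (b : S2 J ι (G ⧸ N))
    (c d : J → G) (hc : ∀ j, (c j : G ⧸ N) = b.1.1 j) (hd : ∀ j, (d j : G ⧸ N) = b.1.2.1 j)
    (hcN : ∀ j, ∀ n : N, Commute (c j) n) (hdN : ∀ j, ∀ n : N, Commute (d j) n)
    (z : J → J → N) (hz : ∀ s t, (z s t : G) = (D d s t)⁻¹ * D c s t) :
    Nat.card {a // S2map (ι := ι) (QuotientGroup.mk' N) a = b} ≤
      Nat.card {q : X J ι N × X J ι N // tw z (pr q.1) = pr q.2} := by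
  let A := {p : (J → G) × (J → G) // (∀ j, (p.1 j : G ⧸ N) = b.1.1 j) ∧
    (∀ j, (p.2 j : G ⧸ N) = b.1.2.1 j) ∧ ∀ s t, D p.1 s t = D p.2 s t}
  let γ : A → Set G := fun a => {g | ∃ j, g = a.1.1 j ∨ g = a.1.2 j}
  refine le_trans ?_ (le_trans (coset_le N γ b.1.2.2) ?_)
  · refine Nat.card_le_card_of_injective
      (fun p => ⟨(⟨(p.1.1.1, p.1.1.2.1), ?_, ?_, ?_⟩, p.1.1.2.2), ?_, ?_⟩) ?_
    · intro j; exact congrArg (fun z => z.1.1 j) p.2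
    · intro j; exact congrArg (fun z => z.1.2.1 j) p.2
    · exact p.1.2.2.2
    · intro i; exact congrArg (fun z => z.1.2.2 i) p.2
    · rintro i g ⟨j, rfl | rfl⟩
      · exact p.1.2.1 j i
      · exact p.1.2.2.1 j i
    · rintro ⟨⟨⟨x, y, m⟩, h⟩, h1⟩ ⟨⟨⟨x', y', m'⟩, h'⟩, h1'⟩ hh
      have e0 := congrArg (fun w => w.1) hh
      have e1 : x = x' := congrArg (fun w => w.1.1.1) e0
      have e2 : y = y' := congrArg (fun w => w.1.1.2) e0
      have e3 : m = m' := congrArg (fun w => w.2) e0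
      subst e1 e2 e3
      rfl
  · have hx : ∀ a : A, ∀ j, (c j)⁻¹ * a.1.1 j ∈ N := fun a j => by
      rw [← QuotientGroup.eq, hc, a.2.1]
    have hy : ∀ a : A, ∀ j, (d j)⁻¹ * a.1.2 j ∈ N := fun a j => by
      rw [← QuotientGroup.eq, hd, a.2.2.1]
    refine Nat.card_le_card_of_injective
      (fun p => ⟨(⟨(fun j => ⟨_, hx p.1.1 j⟩, p.1.2), ?_⟩,
        ⟨(fun j => ⟨_, hy p.1.1 j⟩, p.1.2), ?_⟩), ?_⟩) ?_
    · intro j i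
      exact Subtype.ext ((hcN j _).inv_left.mul_left (p.2 i _ ⟨j, Or.inl rfl⟩))
    · intro j i
      exact Subtype.ext ((hdN j _).inv_left.mul_left (p.2 i _ ⟨j, Or.inr rfl⟩))
    · refine Prod.ext (funext fun s => funext fun t => Subtype.ext ?_) rfl
      set x : J → N := fun j => ⟨_, hx p.1.1 j⟩ with hxd
      set y : J → N := fun j => ⟨_, hy p.1.1 j⟩ with hyd
      show ((z s t * D x s t : N) : G) = ((D y s t : N) : G)
      have e1 := D_mul c (fun j => (x j : G)) (fun i j => hcN i _) s t
      have e2 := D_mul d (fun j => (y j : G)) (fun i j => hdN i _) s t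
      have e3 : (fun j => c j * (x j : G)) = p.1.1.1.1 := by
        funext j; simp [hxd]
      have e4 : (fun j => d j * (y j : G)) = p.1.1.1.2 := by
        funext j; simp [hyd]
      have e5 : D (fun j => (x j : G)) s t = ((D x s t : N) : G) := D_map N.subtype x s t
      have e6 : D (fun j => (y j : G)) s t = ((D y s t : N) : G) := D_map N.subtype y s t
      have e7 := p.1.1.2.2.2 s t
      rw [e3, e5] at e1
      rw [e4, e6] at e2
      rw [e1, e2] at e7
      rw [Subgroup.coe_mul, hz, mul_assoc, e7]
      group
    · rintro ⟨⟨⟨⟨x, y⟩, h⟩, m⟩, h1⟩ ⟨⟨⟨⟨x', y'⟩, h'⟩, m'⟩, h1'⟩ hh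
      have e0 := congrArg (fun w => w.1) hh
      have e1 : x = x' := funext fun j => mul_left_cancel (a := (c j)⁻¹)
        (congrArg (fun w => (w.1.1.1 j : G)) e0)
      have e2 : y = y' := funext fun j => mul_left_cancel (a := (d j)⁻¹)
        (congrArg (fun w => (w.2.1.1 j : G)) e0)
      have e3 : m = m' := congrArg (fun w => w.1.1.2) e0
      subst e1 e2 e3
      rfl

lemma z_exists {G : Type*} [Group G] (N : Subgroup G) [N.Normal]
    {J ι : Type*} [Mul J] (b : S2 J ι (G ⧸ N))
    (c d : J → G) (hc : ∀ j, (c j : G ⧸ N) = b.1.1 j) (hd : ∀ j, (d j : G ⧸ N) = b.1.2.1 j) :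
    ∃ z : J → J → N, ∀ s t, (z s t : G) = (D d s t)⁻¹ * D c s t := by
  refine ⟨fun s t => ⟨(D d s t)⁻¹ * D c s t, ?_⟩, fun s t => rfl⟩
  rw [← QuotientGroup.eq]
  have h1 := D_map (QuotientGroup.mk' N) c s t
  have h2 := D_map (QuotientGroup.mk' N) d s t
  have h3 : (fun j => QuotientGroup.mk' N (c j)) = b.1.1 := funext hc
  have h4 : (fun j => QuotientGroup.mk' N (d j)) = b.1.2.1 := funext hd
  rw [h3] at h1
  rw [h4] at h2
  exact h2.symm.trans ((b.2.2.2 s t).symm.trans h1)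

lemma step2 {G : Type*} [Group G] [Finite G] (N : Subgroup G) [N.Normal]
    (e : (N × (G ⧸ N)) ≃* G) :
    ∃ φ : (G ⧸ N) →* G, (∀ q, (φ q : G ⧸ N) = q) ∧ ∀ q, ∀ n : N, Commute (φ q) n := by
  choose c hc hcN using step1 N e
  have hcard : Nat.card (S2 (G ⧸ N) N G)
      = Nat.card (S2 (G ⧸ N) N (G ⧸ N)) * Nat.card (S2 (G ⧸ N) N N) := by
    rw [← S2_congr e, S2_prod, mul_comm]
  have hle : ∀ b : S2 (G ⧸ N) N (G ⧸ N),
      Nat.card {a // S2map (QuotientGroup.mk' N) a = b} ≤ Nat.card (S2 (G ⧸ N) N N) := by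
    intro b
    obtain ⟨z, hz⟩ := z_exists N b (fun j => c (b.1.1 j)) (fun j => c (b.1.2.1 j))
      (fun j => hc _) (fun j => hc _)
    refine (fibre2 N b _ _ (fun j => hc _) (fun j => hc _) (fun j => hcN _) (fun j => hcN _)
      z hz).trans ?_
    rw [S2_card_X]
    exact (cs_count _ _).1
  let b : S2 (G ⧸ N) N (G ⧸ N) := ⟨(id, 1, 1), fun j i => Commute.one_right _,
    fun j i => Commute.one_right _, fun s t => by simp [D]⟩
  have heq := fibre_eq _ _ hcard hle b
  obtain ⟨z, hz⟩ := z_exists N b c 1 hc (fun j => rfl)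
  have h1 := fibre2 N b c 1 hc (fun j => rfl) hcN (fun j n => Commute.one_left _) z hz
  rw [heq, S2_card_X] at h1
  obtain ⟨⟨y, hy⟩, hyz⟩ := (cs_count _ _).2 (le_antisymm (cs_count _ _).1 h1)
    ⟨(1, id), fun j i => Commute.one_left _⟩
  have hm : y.2 = id := congrArg Prod.snd hyz
  have hD : ∀ s t, D y.1 s t = z s t := by
    intro s t
    have : D y.1 s t = z s t * D (1 : G ⧸ N → N) s t :=
      congrFun (congrFun (congrArg Prod.fst hyz) s) t
    simpa [D] using this
  have hyN : ∀ s (n : N), Commute (y.1 s : G) n := by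
    intro s n
    have := hy s n
    rw [hm] at this
    exact this.map N.subtype
  have hrel : ∀ s t, (y.1 s : G) * y.1 t * (y.1 (s * t) : G)⁻¹ = c s * c t * (c (s * t))⁻¹ := by
    intro s t
    have h2 := congrArg (Subtype.val) (hD s t)
    rw [hz] at h2
    simpa [D] using h2
  refine ⟨MonoidHom.mk' (fun s => (y.1 s : G)⁻¹ * c s) ?_, ?_, ?_⟩
  · intro s t
    have h3 := hrel s t
    have h4 : c s * c t = (y.1 s : G) * y.1 t * (y.1 (s * t) : G)⁻¹ * c (s * t) := by
      rw [h3]; group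
    have h5 : (c s) * (y.1 t : G)⁻¹ = (y.1 t : G)⁻¹ * c s := (hcN s (y.1 t)).inv_right.eq
    have h6 : (y.1 s : G)⁻¹ * (y.1 t : G)⁻¹ = (y.1 t : G)⁻¹ * (y.1 s : G)⁻¹ :=
      ((hyN s (y.1 t)).inv_inv).eq
    symm
    calc (y.1 s : G)⁻¹ * c s * ((y.1 t : G)⁻¹ * c t)
        = (y.1 s : G)⁻¹ * (c s * (y.1 t : G)⁻¹) * c t := by group
      _ = ((y.1 s : G)⁻¹ * (y.1 t : G)⁻¹) * (c s * c t) := by rw [h5]; group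
      _ = (y.1 (s * t) : G)⁻¹ * c (s * t) := by rw [h6, h4]; group
  · intro q
    show (((y.1 q : G)⁻¹ * c q : G) : G ⧸ N) = q
    rw [QuotientGroup.mk_mul, hc, QuotientGroup.mk_inv,
      (QuotientGroup.eq_one_iff _).2 (y.1 q).2]
    simp
  · intro q n
    exact ((hyN q n).inv_left).mul_left (hcN q n)

end DirectExt

/-- The direct extension theorem: if a finite group `G` is the internal direct
product of `H` and `K`, then every normal subgroup `H₀` with `H₀ ≅ H` and
`G/H₀ ≅ K` is a direct factor of `G`. -/
theorem direct_extension
    {G : Type*} [Group G] [Finite G]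
    (H K : Subgroup G) (hH : H.Normal) (hK : K.Normal)
    (hHK : H ⊓ K = ⊥) (hsup : H ⊔ K = ⊤)
    (H₀ : Subgroup G) [H₀.Normal]
    (h₁ : Nonempty (H₀ ≃* H)) (h₂ : Nonempty ((G ⧸ H₀) ≃* K)) :
    ∃ K₀ : Subgroup G, K₀.Normal ∧ H₀ ⊔ K₀ = ⊤ ∧ H₀ ⊓ K₀ = ⊥ := by
  obtain ⟨e₁⟩ := h₁
  obtain ⟨e₂⟩ := h₂
  have hdis : Disjoint H K := disjoint_iff.2 hHK
  have hcomm : ∀ (h : H) (k : K), Commute (h : G) (k : G) := fun h k =>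
    Subgroup.commute_of_normal_of_disjoint H K hH hK hdis h k h.2 k.2
  let f : H × K →* G := MonoidHom.noncommCoprod H.subtype K.subtype hcomm
  have hf : Function.Bijective f := by
    constructor
    · rw [injective_iff_map_eq_one]
      rintro ⟨h, k⟩ hk
      have h1 : (h : G) * k = 1 := hk
      have h2 : (h : G) ∈ K := by
        rw [eq_inv_of_mul_eq_one_left h1]; exact K.inv_mem k.2
      have h3 : (h : G) = 1 := by
        have : (h : G) ∈ H ⊓ K := ⟨h.2, h2⟩
        rwa [hHK, Subgroup.mem_bot] at this
      rw [h3, one_mul] at h1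
      exact Prod.ext (Subtype.ext h3) (Subtype.ext h1)
    · intro g
      have hg : g ∈ H ⊔ K := hsup ▸ Subgroup.mem_top g
      obtain ⟨h, hh, k, hk, rfl⟩ := Subgroup.mem_sup_of_normal_left.1 hg
      exact ⟨(⟨h, hh⟩, ⟨k, hk⟩), rfl⟩
  let e : (H₀ × (G ⧸ H₀)) ≃* G := (e₁.prodCongr e₂).trans (MulEquiv.ofBijective f hf)
  obtain ⟨φ, hφ, hφN⟩ := DirectExt.step2 H₀ e
  have hdec : ∀ g : G, g * (φ (g : G ⧸ H₀))⁻¹ ∈ H₀ := by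
    intro g
    rw [← QuotientGroup.eq_one_iff, QuotientGroup.mk_mul, QuotientGroup.mk_inv, hφ]
    simp
  refine ⟨φ.range, ⟨?_⟩, ?_, ?_⟩
  · rintro _ ⟨q, rfl⟩ g
    refine ⟨(g : G ⧸ H₀) * q * (g : G ⧸ H₀)⁻¹, ?_⟩
    have hc := (hφN ((g : G ⧸ H₀) * q * (g : G ⧸ H₀)⁻¹) ⟨_, hdec g⟩).eq
    simp only [map_mul, map_inv] at hc ⊢
    have h2 := mul_inv_eq_of_eq_mul hc
    rw [← mul_inv_eq_of_eq_mul hc.symm]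
    group
  · rw [eq_top_iff]
    intro g _
    have : g = (g * (φ (g : G ⧸ H₀))⁻¹) * φ (g : G ⧸ H₀) := by group
    rw [this]
    exact Subgroup.mul_mem_sup (hdec g) ⟨_, rfl⟩
  · rw [eq_bot_iff]
    rintro _ ⟨h, ⟨q, rfl⟩⟩
    have : q = 1 := by rw [← hφ q]; exact (QuotientGroup.eq_one_iff _).2 h
    rw [this, map_one]; exact Subgroup.mem_bot.2 rfl
end
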